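/- In the Euclidean geometric algebra G_{n,0,0}, for every vector v and all multivectors x, y, the following two identities hold: v ⌋ (x ∨ y) = (v ⌋ x) ∨ y, and x ∨ (v ⌋ y) = −(−1)^n (v ⌋ x)^ ∨ y, where ⌋ is the left contraction, ∨ is the join, and (·)^ is the grade involution. -/

import Mathlib

open CliffordAlgebra

noncomputable section

/-- The quadratic form of the geometric algebra `G_{n,0,r}`: the first `n` coordinates are
orthogonal basis vectors `e_1, …, e_n` of square `+1`, while the remaining `r` coordinates
are degenerate directions of square `0` (when `r = 1`, the last coordinate is `e_0`). -/
def gaForm (n r : ℕ) : QuadraticForm ℝ (Fin (n + r) → ℝ) :=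
  QuadraticMap.weightedSumSquares ℝ (fun i : Fin (n + r) => if (i : ℕ) < n then (1 : ℝ) else 0)

/-- The geometric algebra `G_{n,0,r}`, as a real Clifford algebra. -/
abbrev GA (n r : ℕ) := CliffordAlgebra (gaForm n r)

/-- The `i`-th basis vector of the underlying quadratic space. -/
def gaBasisVec (n r : ℕ) (i : Fin (n + r)) : Fin (n + r) → ℝ := Pi.single i 1

/-- The `i`-th basis vector, embedded in the geometric algebra. -/
def eVec (n r : ℕ) (i : Fin (n + r)) : GA n r := ι (gaForm n r) (gaBasisVec n r i)

instance : Invertible (2 : ℝ) := invertibleOfNonzero two_ne_zero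

/-- The canonical linear equivalence with the exterior algebra (used to transport the
grading and the wedge product to the Clifford algebra). -/
def gaToExt (n r : ℕ) : GA n r ≃ₗ[ℝ] ExteriorAlgebra ℝ (Fin (n + r) → ℝ) :=
  CliffordAlgebra.equivExterior (gaForm n r)

/-- Grade-`k` projection `⟨x⟩_k` of a multivector, setting all non-grade-`k`
components to zero. -/
def gradeProj (n r : ℕ) (k : ℕ) : GA n r →ₗ[ℝ] GA n r :=
  (gaToExt n r).symm.toLinearMap ∘ₗ
    (GradedAlgebra.proj (fun i : ℕ => ⋀[ℝ]^i (Fin (n + r) → ℝ)) k) ∘ₗ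
      (gaToExt n r).toLinearMap

/-- Wedge (exterior) product of multivectors. -/
def wedge (n r : ℕ) (x y : GA n r) : GA n r :=
  (gaToExt n r).symm (gaToExt n r x * gaToExt n r y)

/-- The versor (geometric product of vectors) associated to a list of vectors. -/
def versor (n r : ℕ) (l : List (Fin (n + r) → ℝ)) : GA n r :=
  (l.map (ι (gaForm n r))).prod

/-- `IsUnitVecList n r l` : every vector in the list `l` is an (invertible) unit vector,
so that `versor n r l` is an element of the Pin group. -/
def IsUnitVecList (n r : ℕ) (l : List (Fin (n + r) → ℝ)) : Prop :=
  ∀ v ∈ l, gaForm n r v = 1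

/-- The sandwich action `u[x]` of the Pin-group element `u = v_1 ⋯ v_k` (presented by the
list `l = [v_1, …, v_k]` of unit vectors) on a multivector `x`: `u[x] = u x̂ u⁻¹` if `u` is
odd and `u[x] = u x u⁻¹` if `u` is even, where `x̂` is the grade involution and where
`u⁻¹ = ũ` (the reversal) for a product of unit vectors. -/
def pinAction (n r : ℕ) (l : List (Fin (n + r) → ℝ)) (x : GA n r) : GA n r :=
  versor n r l * ((⇑(involute (Q := gaForm n r)))^[l.length] x) * reverse (versor n r l)

/-- The blade (wedge product) determined by a list of vectors. -/
def bladeList (n r : ℕ) (vs : List (Fin (n + r) → ℝ)) : GA n r :=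
  vs.foldr (fun v acc => wedge n r (ι (gaForm n r) v) acc) 1

/-- `IsBlade n r k x` : `x` is a `k`-blade, i.e. a (scaled) wedge product of `k` vectors. -/
def IsBlade (n r : ℕ) (k : ℕ) (x : GA n r) : Prop :=
  ∃ (c : ℝ) (vs : List (Fin (n + r) → ℝ)), vs.length = k ∧ x = c • bladeList n r vs

/-- Scalar (grade-0) coefficient of a multivector. -/
def scalarCoeff (n r : ℕ) (x : GA n r) : ℝ :=
  ExteriorAlgebra.algebraMapInv (gaToExt n r x)

/-- Squared norm `‖x‖² = ⟨x x̃⟩₀` of a multivector. -/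
def gaNormSq (n r : ℕ) (x : GA n r) : ℝ :=
  scalarCoeff n r (x * reverse x)

/-- Norm `‖x‖ = √⟨x x̃⟩₀` of a multivector. -/
def gaNorm (n r : ℕ) (x : GA n r) : ℝ := Real.sqrt (gaNormSq n r x)

/-- Left contraction `v ⌋ x` of a multivector `x` by a vector `v`, defined gradewise by
`v ⌋ ⟨x⟩_l = ⟨ v ⟨x⟩_l ⟩_{l-1}`. -/
def vContr (n r : ℕ) (v : Fin (n + r) → ℝ) (x : GA n r) : GA n r :=
  ∑ l ∈ Finset.range (n + r + 1),
    gradeProj n r (l - 1) (ι (gaForm n r) v * gradeProj n r l x)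

/-- The Euclidean pseudoscalar `e_1 e_2 ⋯ e_n`, the geometric product of the
non-degenerate basis vectors. -/
def eucPseudoscalar (n r : ℕ) : GA n r :=
  (((List.finRange (n + r)).filter (fun i : Fin (n + r) => decide ((i : ℕ) < n))).map
    (eVec n r)).prod

/-- Euclidean dual `x* = x Ĩ` in `G_{n,0,0}`, with `I = e_1 ⋯ e_n`. -/
def eucDual (n : ℕ) (x : GA n 0) : GA n 0 := x * reverse (eucPseudoscalar n 0)

/-- Euclidean inverse dual `x^{-*} = x I` in `G_{n,0,0}`. -/
def eucInvDual (n : ℕ) (x : GA n 0) : GA n 0 := x * eucPseudoscalar n 0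

/-- Euclidean join `x ∨ y = (x* ∧ y*)^{-*}` in `G_{n,0,0}`. -/
def eucJoin (n : ℕ) (x y : GA n 0) : GA n 0 :=
  eucInvDual n (wedge n 0 (eucDual n x) (eucDual n y))

section Helpers

/-- The linear form `B(v, ·)` attached to a vector. -/
def bForm (n r : ℕ) (v : Fin (n + r) → ℝ) : Module.Dual ℝ (Fin (n + r) → ℝ) :=
  QuadraticMap.associated (R := ℝ) (gaForm n r) v

/-- Contraction by `v` through Mathlib's `contractLeft`. -/
def ctr (n r : ℕ) (v : Fin (n + r) → ℝ) (x : GA n r) : GA n r :=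
  contractLeft (Q := gaForm n r) (bForm n r v) x

theorem gaToExt_ι_mul (n r : ℕ) (v : Fin (n + r) → ℝ) (x : GA n r) :
    gaToExt n r (ι (gaForm n r) v * x) =
      ExteriorAlgebra.ι ℝ v * gaToExt n r x +
        contractLeft (Q := (0 : QuadraticForm ℝ (Fin (n + r) → ℝ))) (bForm n r v)
          (gaToExt n r x) := by
  have h := changeForm_ι_mul (changeForm.associated_neg_proof (Q := gaForm n r)) v x
  have hB : QuadraticMap.associated (R := ℝ) (-(gaForm n r)) v = - bForm n r v := by
    rw [map_neg]; rfl
  have hc : ∀ y, contractLeft (Q := (0 : QuadraticForm ℝ (Fin (n + r) → ℝ))) (- bForm n r v) y =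
      - contractLeft (Q := (0 : QuadraticForm ℝ (Fin (n + r) → ℝ))) (bForm n r v) y := fun y => by
    rw [LinearMap.map_neg, LinearMap.neg_apply]
  rw [hB, hc, sub_neg_eq_add] at h
  exact h

theorem gaToExt_ctr (n r : ℕ) (d : Module.Dual ℝ (Fin (n + r) → ℝ)) (x : GA n r) :
    gaToExt n r (contractLeft d x) =
      contractLeft (Q := (0 : QuadraticForm ℝ (Fin (n + r) → ℝ))) d (gaToExt n r x) :=
  changeForm_contractLeft (changeForm.associated_neg_proof (Q := gaForm n r)) d x

theorem gaToExt_ι (n r : ℕ) (v : Fin (n + r) → ℝ) :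
    gaToExt n r (ι (gaForm n r) v) = ExteriorAlgebra.ι ℝ v :=
  changeForm_ι (changeForm.associated_neg_proof (Q := gaForm n r)) v

theorem gaToExt_algebraMap (n r : ℕ) (c : ℝ) :
    gaToExt n r (algebraMap ℝ _ c) = algebraMap ℝ _ c :=
  changeForm_algebraMap (changeForm.associated_neg_proof (Q := gaForm n r)) c

theorem contractLeft_involute' {M : Type*} [AddCommGroup M] [Module ℝ M] {Q : QuadraticForm ℝ M}
    (d : Module.Dual ℝ M) (x : CliffordAlgebra Q) :
    contractLeft d (involute x) = - involute (contractLeft d x) := by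
  induction x using CliffordAlgebra.left_induction with
  | algebraMap c => simp
  | add x y hx hy => simp only [map_add, hx, hy, neg_add]
  | ι_mul x m hx =>
    simp only [map_mul, involute_ι, neg_mul, map_neg, contractLeft_ι_mul, hx, map_sub, map_smul,
      mul_neg]

theorem gaToExt_involute (n r : ℕ) (x : GA n r) :
    gaToExt n r (involute x) =
      involute (Q := (0 : QuadraticForm ℝ (Fin (n + r) → ℝ))) (gaToExt n r x) := by
  induction x using CliffordAlgebra.left_induction with
  | algebraMap c =>
    rw [AlgHom.commutes, gaToExt_algebraMap]
    exact (AlgHom.commutes _ _).symm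
  | add x y hx hy => simp only [map_add, hx, hy]
  | ι_mul x m hx =>
    have h1 : involute (Q := (0 : QuadraticForm ℝ (Fin (n + r) → ℝ))) (ExteriorAlgebra.ι ℝ m) =
      - ExteriorAlgebra.ι ℝ m := involute_ι m
    rw [map_mul, involute_ι, neg_mul, map_neg, gaToExt_ι_mul, gaToExt_ι_mul, map_add, map_mul, hx,
      contractLeft_involute', h1]
    rw [neg_add, neg_neg, neg_mul]

theorem ext_mul_ι {M : Type*} [AddCommGroup M] [Module ℝ M] (x : ExteriorAlgebra ℝ M) (v : M) :
    x * ExteriorAlgebra.ι ℝ v =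
      ExteriorAlgebra.ι ℝ v * involute (Q := (0 : QuadraticForm ℝ M)) x := by
  induction x using CliffordAlgebra.left_induction with
  | algebraMap c =>
    have : involute (Q := (0 : QuadraticForm ℝ M)) (algebraMap ℝ _ c) = algebraMap ℝ _ c :=
      AlgHom.commutes _ _
    rw [this]
    exact Algebra.commutes _ _
  | add x y hx hy => rw [add_mul, map_add, mul_add, hx, hy]
  | ι_mul x m hx =>
    have h2 : ExteriorAlgebra.ι ℝ m * ExteriorAlgebra.ι ℝ v =
      - (ExteriorAlgebra.ι ℝ v * ExteriorAlgebra.ι ℝ m) :=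
      eq_neg_of_add_eq_zero_left (ExteriorAlgebra.ι_add_mul_swap m v)
    rw [map_mul, involute_ι, mul_assoc, hx, ← mul_assoc]
    change ExteriorAlgebra.ι ℝ m * ExteriorAlgebra.ι ℝ v * _ =
      ExteriorAlgebra.ι ℝ v * (- ExteriorAlgebra.ι ℝ m * _)
    rw [h2, neg_mul, neg_mul, mul_neg, mul_assoc]

theorem contractLeft_mem {M : Type*} [AddCommGroup M] [Module ℝ M] (d : Module.Dual ℝ M)
    {l : ℕ} {x : ExteriorAlgebra ℝ M} (hx : x ∈ ⋀[ℝ]^l M) :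
    (l = 0 → contractLeft (Q := (0 : QuadraticForm ℝ M)) d x = 0) ∧
      contractLeft (Q := (0 : QuadraticForm ℝ M)) d x ∈ ⋀[ℝ]^(l - 1) M := by
  induction hx using Submodule.pow_induction_on_left' with
  | algebraMap c =>
    have : contractLeft (Q := (0 : QuadraticForm ℝ M)) d (algebraMap ℝ _ c) = 0 :=
      contractLeft_algebraMap _ _ _
    exact ⟨fun _ => this, by rw [this]; exact Submodule.zero_mem _⟩
  | add x y i hx hy ihx ihy =>
    rw [map_add]
    exact ⟨fun h => by rw [ihx.1 h, ihy.1 h, add_zero], Submodule.add_mem _ ihx.2 ihy.2⟩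
  | mem_mul m hm i x hx ih =>
    obtain ⟨m, rfl⟩ := hm
    have h : contractLeft (Q := (0 : QuadraticForm ℝ M)) d (ExteriorAlgebra.ι ℝ m * x) =
      d m • x - ExteriorAlgebra.ι ℝ m * contractLeft (Q := (0 : QuadraticForm ℝ M)) d x :=
      contractLeft_ι_mul _ _ _
    rw [h]
    refine ⟨fun h => by simp at h, ?_⟩
    refine Submodule.sub_mem _ (Submodule.smul_mem _ _ hx) ?_
    rcases i with _ | i
    · rw [ih.1 rfl, mul_zero]; exact Submodule.zero_mem _
    · have h3 := Submodule.mul_mem_mul (LinearMap.mem_range_self (ExteriorAlgebra.ι ℝ) m) ih.2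
      change _ ∈ LinearMap.range (ExteriorAlgebra.ι ℝ) ^ (i + 1)
      rw [pow_succ']
      exact h3

theorem ext_high (m l : ℕ) (h : m < l) (x : ExteriorAlgebra ℝ (Fin m → ℝ))
    (hx : x ∈ ⋀[ℝ]^l (Fin m → ℝ)) : x = 0 := by
  have h1 : Module.finrank ℝ (⋀[ℝ]^l (Fin m → ℝ)) = 0 := by
    rw [exteriorPower.finrank_eq, Module.finrank_fin_fun, Nat.choose_eq_zero_of_lt h]
  have h2 := Submodule.finrank_eq_zero.mp h1
  rw [h2] at hx
  exact (Submodule.mem_bot ℝ).1 hx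

theorem ext_sum (m : ℕ) (x : ExteriorAlgebra ℝ (Fin m → ℝ)) :
    ∑ l ∈ Finset.range (m + 1),
      GradedAlgebra.proj (fun i : ℕ => ⋀[ℝ]^i (Fin m → ℝ)) l x = x := by
  classical
  conv_rhs => rw [← DirectSum.sum_support_decompose (fun i : ℕ => ⋀[ℝ]^i (Fin m → ℝ)) x]
  symm
  apply Finset.sum_subset_zero_on_sdiff
  · intro l hl
    rw [DFinsupp.mem_support_toFun] at hl
    rw [Finset.mem_range]
    by_contra hlt
    exact hl (Subtype.ext (ext_high m l (by omega) _ (SetLike.coe_mem _)))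
  · intro l hl
    rw [Finset.mem_sdiff, DFinsupp.notMem_support_iff] at hl
    rw [GradedAlgebra.proj_apply, hl.2]; rfl
  · intro l _
    rw [GradedAlgebra.proj_apply]

theorem vContr_eq (n r : ℕ) (v : Fin (n + r) → ℝ) (x : GA n r) :
    vContr n r v x = ctr n r v x := by
  apply (gaToExt n r).injective
  unfold vContr ctr
  rw [gaToExt_ctr, map_sum]
  conv_rhs => rw [← ext_sum (n + r) (gaToExt n r x), map_sum]
  refine Finset.sum_congr rfl fun l _ => ?_
  simp only [gradeProj, LinearMap.comp_apply, LinearEquiv.coe_coe, LinearEquiv.apply_symm_apply,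
    gaToExt_ι_mul]
  have hm : GradedAlgebra.proj (fun i : ℕ => ⋀[ℝ]^i (Fin (n + r) → ℝ)) l (gaToExt n r x) ∈
      ⋀[ℝ]^l (Fin (n + r) → ℝ) := by
    rw [GradedAlgebra.proj_apply]; exact SetLike.coe_mem _
  generalize GradedAlgebra.proj (fun i : ℕ => ⋀[ℝ]^i (Fin (n + r) → ℝ)) l (gaToExt n r x) = y at *
  have h3 : ExteriorAlgebra.ι ℝ v * y ∈ ⋀[ℝ]^(l + 1) (Fin (n + r) → ℝ) := by
    change _ ∈ LinearMap.range (ExteriorAlgebra.ι ℝ) ^ (l + 1)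
    rw [pow_succ']
    exact Submodule.mul_mem_mul (LinearMap.mem_range_self (ExteriorAlgebra.ι ℝ) v) hm
  rw [map_add, GradedAlgebra.proj_apply, GradedAlgebra.proj_apply,
    DirectSum.decompose_of_mem_ne (fun i : ℕ => ⋀[ℝ]^i (Fin (n + r) → ℝ)) h3 (by omega), zero_add]
  exact DirectSum.decompose_of_mem_same (fun i : ℕ => ⋀[ℝ]^i (Fin (n + r) → ℝ))
    (contractLeft_mem _ hm).2

theorem involute_mul_ι (n r : ℕ) (v : Fin (n + r) → ℝ) (x : GA n r) :
    involute x * ι (gaForm n r) v = ι (gaForm n r) v * x - (2 : ℝ) • ctr n r v x := by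
  unfold ctr
  induction x using CliffordAlgebra.left_induction with
  | algebraMap c => simp [Algebra.commutes]
  | add x y hx hy =>
    simp only [map_add, add_mul, mul_add, smul_add, hx, hy]; abel
  | ι_mul x m hx =>
    have h1 : ι (gaForm n r) m * ι (gaForm n r) v =
        (2 * bForm n r v m) • 1 - ι (gaForm n r) v * ι (gaForm n r) m := by
      rw [ι_mul_ι_comm, Algebra.algebraMap_eq_smul_one]
      congr 2
      rw [QuadraticMap.polar_comm]
      simp [bForm, QuadraticMap.associated_apply, QuadraticMap.polar]
    rw [map_mul, involute_ι, mul_assoc, hx, contractLeft_ι_mul, neg_mul, mul_sub, ← mul_assoc, h1,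
      sub_mul, smul_mul_assoc, one_mul, mul_smul_comm, smul_sub, smul_smul, mul_assoc]
    abel

theorem wedge_ι (n r : ℕ) (v : Fin (n + r) → ℝ) (x : GA n r) :
    wedge n r (ι (gaForm n r) v) x = ι (gaForm n r) v * x - ctr n r v x := by
  apply (gaToExt n r).injective
  unfold wedge ctr
  rw [LinearEquiv.apply_symm_apply, map_sub, gaToExt_ι_mul, gaToExt_ctr, gaToExt_ι,
    add_sub_cancel_right]

theorem wedge_assoc' (n r : ℕ) (x y z : GA n r) :
    wedge n r (wedge n r x y) z = wedge n r x (wedge n r y z) := by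
  simp [wedge, mul_assoc]

theorem wedge_swap (n r : ℕ) (v : Fin (n + r) → ℝ) (x : GA n r) :
    wedge n r x (ι (gaForm n r) v) = wedge n r (ι (gaForm n r) v) (involute x) := by
  unfold wedge
  rw [gaToExt_ι, gaToExt_involute, ext_mul_ι]

theorem two_ctr (n r : ℕ) (v : Fin (n + r) → ℝ) (x : GA n r) :
    (2 : ℝ) • ctr n r v x = ι (gaForm n r) v * x - involute x * ι (gaForm n r) v := by
  rw [involute_mul_ι]; abel

theorem two_wedge (n r : ℕ) (v : Fin (n + r) → ℝ) (x : GA n r) :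
    (2 : ℝ) • wedge n r (ι (gaForm n r) v) x =
      ι (gaForm n r) v * x + involute x * ι (gaForm n r) v := by
  rw [wedge_ι, smul_sub, two_ctr, two_smul]; abel

theorem ctr_mul_ps (n r : ℕ) (v : Fin (n + r) → ℝ) (J x : GA n r)
    (hJ : involute J * ι (gaForm n r) v = - (ι (gaForm n r) v * J)) :
    ctr n r v x * J = wedge n r (ι (gaForm n r) v) (x * J) := by
  apply smul_right_injective (GA n r) (two_ne_zero (α := ℝ))
  change (2 : ℝ) • (ctr n r v x * J) = (2 : ℝ) • wedge n r (ι (gaForm n r) v) (x * J)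
  rw [two_wedge, ← smul_mul_assoc, two_ctr, map_mul, mul_assoc (involute x), hJ]
  noncomm_ring

theorem ctr_of_mul_ps (n r : ℕ) (v : Fin (n + r) → ℝ) (J x : GA n r)
    (hJ : involute J * ι (gaForm n r) v = - (ι (gaForm n r) v * J)) :
    ctr n r v (x * J) = wedge n r (ι (gaForm n r) v) x * J := by
  apply smul_right_injective (GA n r) (two_ne_zero (α := ℝ))
  change (2 : ℝ) • ctr n r v (x * J) = (2 : ℝ) • (wedge n r (ι (gaForm n r) v) x * J)
  rw [two_ctr, ← smul_mul_assoc, two_wedge, map_mul, mul_assoc (involute x), hJ]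
  noncomm_ring

theorem eVec_anti (n r : ℕ) {i j : Fin (n + r)} (h : i ≠ j) :
    eVec n r i * eVec n r j = - (eVec n r j * eVec n r i) := by
  unfold eVec
  rw [ι_mul_ι_comm]
  have : QuadraticMap.polar (gaForm n r) (gaBasisVec n r i) (gaBasisVec n r j) = 0 := by
    simp only [QuadraticMap.polar, gaForm, QuadraticMap.weightedSumSquares_apply, gaBasisVec,
      ← Finset.sum_sub_distrib]
    refine Finset.sum_eq_zero fun k _ => ?_
    by_cases hi : k = i
    · subst hi; simp [h]
    · simp [hi]
  rw [this, map_zero, zero_sub]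

theorem list_ps (n r : ℕ) (i : Fin (n + r)) (L : List (Fin (n + r))) (hL : L.Nodup) :
    (i ∈ L → involute (L.map (eVec n r)).prod * eVec n r i =
        - (eVec n r i * (L.map (eVec n r)).prod)) ∧
      (i ∉ L → involute (L.map (eVec n r)).prod * eVec n r i =
        eVec n r i * (L.map (eVec n r)).prod) := by
  induction L with
  | nil => simp
  | cons j L ih =>
    rw [List.nodup_cons] at hL
    have ih := ih hL.2
    have hinv : involute (eVec n r j) = - eVec n r j := involute_ι _
    simp only [List.map_cons, List.prod_cons, map_mul, hinv, mul_assoc]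
    by_cases hij : i = j
    · subst hij
      simp [ih.2 hL.1]
    · have ha := eVec_anti n r (Ne.symm hij)
      constructor
      · intro hi
        have hi : i ∈ L := by simpa [hij] using hi
        rw [ih.1 hi, neg_mul_neg, ← mul_assoc, ha, neg_mul, mul_assoc]
      · intro hi
        have hi : i ∉ L := by simpa [hij] using hi
        rw [ih.2 hi, neg_mul, ← mul_assoc, ha, neg_mul, neg_neg, mul_assoc]

theorem ps_eq (n : ℕ) : eucPseudoscalar n 0 = ((List.finRange (n + 0)).map (eVec n 0)).prod := by
  unfold eucPseudoscalar
  rw [List.filter_eq_self.2]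
  intro i _
  simp

theorem ps_anti (n : ℕ) (v : Fin (n + 0) → ℝ) :
    involute (eucPseudoscalar n 0) * ι (gaForm n 0) v =
      - (ι (gaForm n 0) v * eucPseudoscalar n 0) := by
  have hv : ι (gaForm n 0) v = ∑ i, v i • eVec n 0 i := by
    conv_lhs => rw [pi_eq_sum_univ' v]
    rw [map_sum]
    refine Finset.sum_congr rfl fun i _ => ?_
    rw [map_smul]
    unfold eVec gaBasisVec
    congr 2
  rw [hv, Finset.mul_sum, Finset.sum_mul, ← Finset.sum_neg_distrib, ps_eq]
  refine Finset.sum_congr rfl fun i _ => ?_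
  rw [mul_smul_comm, smul_mul_assoc,
    (list_ps n 0 i _ (List.nodup_finRange _)).1 (List.mem_finRange i), smul_neg]

theorem ps_rev_anti (n : ℕ) (v : Fin (n + 0) → ℝ) :
    involute (reverse (eucPseudoscalar n 0)) * ι (gaForm n 0) v =
      - (ι (gaForm n 0) v * reverse (eucPseudoscalar n 0)) := by
  have h := congrArg (fun z => involute (reverse z)) (ps_anti n v)
  simp only [reverse.map_mul, map_neg, reverse_ι, map_mul, involute_ι, reverse_involute,
    involute_involute] at h
  rw [mul_neg, neg_neg, neg_mul] at h
  exact h.symm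

theorem ps_involute (n : ℕ) :
    involute (reverse (eucPseudoscalar n 0)) =
      (-1 : ℝ) ^ n • reverse (eucPseudoscalar n 0) := by
  have h := involute_prod_map_ι (Q := gaForm n 0) ((List.finRange (n + 0)).map (gaBasisVec n 0))
  rw [List.map_map] at h
  rw [← reverse_involute, ps_eq, ← map_smul]
  have he : (ι (gaForm n 0)) ∘ gaBasisVec n 0 = eVec n 0 := rfl
  rw [he, List.length_map, List.length_finRange] at h
  rw [h]; rfl

end Helpers

/-- In `G_{n,0,0}`, for every vector `v` and all multivectors `x, y`:
`v ⌋ (x ∨ y) = (v ⌋ x) ∨ y` and `x ∨ (v ⌋ y) = −(−1)^n (v ⌋ x)^ ∨ y`. -/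
theorem contraction_join_identities (n : ℕ) (v : Fin (n + 0) → ℝ) (x y : GA n 0) :
    vContr n 0 v (eucJoin n x y) = eucJoin n (vContr n 0 v x) y ∧
      eucJoin n x (vContr n 0 v y) =
        (-(-1 : ℝ) ^ n) • eucJoin n (involute (vContr n 0 v x)) y := by
  simp only [vContr_eq]
  have key : ∀ z, eucDual n (ctr n 0 v z) = wedge n 0 (ι (gaForm n 0) v) (eucDual n z) :=
    fun z => ctr_mul_ps n 0 v _ z (ps_rev_anti n v)
  constructor
  · unfold eucJoin
    rw [key, wedge_assoc']
    exact ctr_of_mul_ps n 0 v _ _ (ps_anti n v)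
  · have h1 : involute (ctr n 0 v x) = - ctr n 0 v (involute x) := by
      unfold ctr; rw [contractLeft_involute', neg_neg]
    have h2 : involute (eucDual n x) = (-1 : ℝ) ^ n • eucDual n (involute x) := by
      unfold eucDual; rw [map_mul, ps_involute, mul_smul_comm]
    have h3 : eucDual n (- ctr n 0 v (involute x)) = - eucDual n (ctr n 0 v (involute x)) := by
      unfold eucDual; rw [neg_mul]
    unfold eucJoin
    rw [h1, h3, key, key, ← wedge_assoc', wedge_swap, h2]
    simp [wedge, eucInvDual]

end
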